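/- For every n ∈ ℕ and every integer s with 1 ≤ s ≤ m_n − 1, one has the pointwise identity s M_n K_{s M_n}(x) = Σ_{l=0}^{s−1} (Σ_{i=0}^{l−1} r_n(x)^i) · M_n D_{M_n}(x) + (Σ_{l=0}^{s−1} r_n(x)^l) · M_n K_{M_n}(x) for all x ∈ G_m. -/

import Mathlib

open MeasureTheory Finset

noncomputable section

namespace Vilenkin

instance (n : ℕ) : MeasurableSpace (ZMod n) := ⊤

abbrev G (m : ℕ → ℕ) : Type := ∀ k, ZMod (m k)

def M (m : ℕ → ℕ) : ℕ → ℕ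
  | 0 => 1
  | k + 1 => m k * M m k

def digit (m : ℕ → ℕ) (n k : ℕ) : ℕ := (n / M m k) % m k

def rad (m : ℕ → ℕ) (k : ℕ) (x : G m) : ℂ :=
  Complex.exp (2 * (Real.pi : ℂ) * Complex.I * ((x k).val : ℂ) / (m k : ℂ))

def psi (m : ℕ → ℕ) (n : ℕ) (x : G m) : ℂ :=
  ∏ k ∈ Finset.range (n + 1), rad m k x ^ digit m n k

def D (m : ℕ → ℕ) (n : ℕ) (x : G m) : ℂ := ∑ k ∈ Finset.range n, psi m k x

def K (m : ℕ → ℕ) (n : ℕ) (x : G m) : ℂ := (n : ℂ)⁻¹ * ∑ k ∈ Finset.range n, D m k x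

def cyl (m : ℕ → ℕ) (n : ℕ) (x : G m) : Set (G m) := {y | ∀ j < n, y j = x j}

def e (m : ℕ → ℕ) (k : ℕ) : G m := fun j => if j = k then 1 else 0

def lo (m : ℕ → ℕ) (n : ℕ) : ℕ := sInf {j | digit m n j ≠ 0}

def hi (m : ℕ → ℕ) (n : ℕ) : ℕ := sSup {j | digit m n j ≠ 0}

def Iij (m : ℕ → ℕ) (N i j : ℕ) : Set (G m) :=
  if j = N then {x | x i ≠ 0 ∧ ∀ t < N, t ≠ i → x t = 0}
  else {x | (∀ t < i, x t = 0) ∧ x i ≠ 0 ∧ (∀ t, i < t → t < j → x t = 0) ∧ x j ≠ 0}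

def IsVilenkinMeasure (m : ℕ → ℕ) (μ : Measure (G m)) : Prop :=
  IsProbabilityMeasure μ ∧ ∀ (n : ℕ) (x : G m), μ (cyl m n x) = (M m n : ENNReal)⁻¹

def fhat (m : ℕ → ℕ) (μ : Measure (G m)) (f : G m → ℂ) (k : ℕ) : ℂ :=
  ∫ x, f x * (starRingEnd ℂ) (psi m k x) ∂μ

def S (m : ℕ → ℕ) (μ : Measure (G m)) (f : G m → ℂ) (n : ℕ) (x : G m) : ℂ :=
  ∑ k ∈ Finset.range n, fhat m μ f k * psi m k x

def sigma (m : ℕ → ℕ) (μ : Measure (G m)) (f : G m → ℂ) (n : ℕ) (x : G m) : ℂ :=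
  (n : ℂ)⁻¹ * ∑ k ∈ Finset.range n, S m μ f k x

end Vilenkin

open Vilenkin

namespace Vilenkin

lemma M_pos' (m : ℕ → ℕ) (hm : ∀ k, 2 ≤ m k) (k : ℕ) : 0 < M m k := by
  induction k with
  | zero => simp [M]
  | succ k ih => exact Nat.mul_pos (by have := hm k; omega) ih

lemma lt_M' (m : ℕ → ℕ) (hm : ∀ k, 2 ≤ m k) (k : ℕ) : k < M m k := by
  induction k with
  | zero => simp [M]
  | succ k ih =>
    have : 2 * M m k ≤ m k * M m k := Nat.mul_le_mul_right _ (hm k)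
    change k + 1 < m k * M m k
    omega

lemma M_dvd' (m : ℕ → ℕ) {a b : ℕ} (h : a ≤ b) : M m a ∣ M m b := by
  induction b, h using Nat.le_induction with
  | base => exact dvd_rfl
  | succ b _ ih => exact ih.trans (Dvd.intro_left _ rfl)

lemma digit_zero' (m : ℕ → ℕ) (hm : ∀ k, 2 ≤ m k) {k N j : ℕ} (h : k < M m N) (hj : N ≤ j) :
    digit m k j = 0 := by
  have : M m N ≤ M m j := Nat.le_of_dvd (M_pos' m hm j) (M_dvd' m hj)
  simp [digit, Nat.div_eq_of_lt (h.trans_le this)]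

lemma prod_ext' (m : ℕ → ℕ) (hm : ∀ k, 2 ≤ m k) {k N N' : ℕ} (h : k < M m N) (hN : N ≤ N')
    (x : G m) : ∏ j ∈ Finset.range N, rad m j x ^ digit m k j
      = ∏ j ∈ Finset.range N', rad m j x ^ digit m k j := by
  apply Finset.prod_subset
  · intro a; simp only [Finset.mem_range]; omega
  · intro a _ ha
    simp only [Finset.mem_range, not_lt] at ha
    rw [digit_zero' m hm h ha, pow_zero]

lemma psi_eq' (m : ℕ → ℕ) (hm : ∀ k, 2 ≤ m k) {k N : ℕ} (h : k < M m N) (x : G m) :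
    psi m k x = ∏ j ∈ Finset.range N, rad m j x ^ digit m k j := by
  have h1 : k < M m (k + 1) := (Nat.lt_succ_self k).trans (lt_M' m hm (k + 1))
  rw [psi, prod_ext' m hm h1 (le_max_left (k + 1) N), ← prod_ext' m hm h (le_max_right (k + 1) N)]

lemma psi_add' (m : ℕ → ℕ) (hm : ∀ k, 2 ≤ m k) {n l j : ℕ} (hl : l < m n) (hj : j < M m n)
    (x : G m) : psi m (l * M m n + j) x = rad m n x ^ l * psi m j x := by
  have h1 : l * M m n + j < M m (n + 1) := by
    have : (l + 1) * M m n ≤ m n * M m n := Nat.mul_le_mul_right _ hl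
    change _ < m n * M m n
    nlinarith
  have hd : digit m (l * M m n + j) n = l := by
    unfold digit
    rw [add_comm, Nat.add_mul_div_right _ _ (M_pos' m hm n), Nat.div_eq_of_lt hj, zero_add,
      Nat.mod_eq_of_lt hl]
  rw [psi_eq' m hm h1, psi_eq' m hm hj, Finset.prod_range_succ, hd, mul_comm]
  congr 1
  apply Finset.prod_congr rfl
  intro i hi
  rw [Finset.mem_range] at hi
  congr 1
  obtain ⟨c, hc⟩ := M_dvd' m (show i + 1 ≤ n from hi)
  unfold digit
  have : l * M m n + j = j + (m i * (c * l)) * M m i := by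
    rw [hc]; change l * (m i * M m i * c) + j = _; ring
  rw [this, Nat.add_mul_div_right _ _ (M_pos' m hm i), Nat.add_mul_mod_self_left]

lemma D_add' (m : ℕ → ℕ) (hm : ∀ k, 2 ≤ m k) {n l : ℕ} (x : G m) (hl : l < m n) :
    ∀ j ≤ M m n, D m (l * M m n + j) x
      = (∑ i ∈ Finset.range l, rad m n x ^ i) * D m (M m n) x + rad m n x ^ l * D m j x := by
  have step : ∀ l < m n, ∀ j ≤ M m n, D m (l * M m n + j) x
      = D m (l * M m n) x + rad m n x ^ l * D m j x := by
    intro l hl j hj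
    simp only [D]
    rw [Finset.sum_range_add, Finset.mul_sum]
    congr 1
    apply Finset.sum_congr rfl
    intro i hi
    rw [Finset.mem_range] at hi
    exact psi_add' m hm hl (hi.trans_le hj) x
  have base : ∀ l < m n, D m (l * M m n) x
      = (∑ i ∈ Finset.range l, rad m n x ^ i) * D m (M m n) x := by
    intro l
    induction l with
    | zero => intro _; simp [D]
    | succ l ih =>
      intro h
      rw [Nat.succ_mul, step l (by omega) _ le_rfl, ih (by omega), Finset.sum_range_succ, add_mul]
  intro j hj
  rw [step l hl j hj, base l hl]

lemma sumD' (m : ℕ → ℕ) (hm : ∀ k, 2 ≤ m k) (n : ℕ) (x : G m) (s : ℕ) (hs : s ≤ m n) :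
    ∑ k ∈ Finset.range (s * M m n), D m k x =
      (∑ l ∈ Finset.range s, ∑ i ∈ Finset.range l, rad m n x ^ i) * (M m n : ℂ) * D m (M m n) x
      + (∑ l ∈ Finset.range s, rad m n x ^ l) * ∑ k ∈ Finset.range (M m n), D m k x := by
  induction s with
  | zero => simp
  | succ s ih =>
    rw [Nat.succ_mul, Finset.sum_range_add, ih (by omega), Finset.sum_range_succ,
      Finset.sum_range_succ (fun l => rad m n x ^ l) s]
    rw [Finset.sum_congr rfl (fun j hj =>
      D_add' m hm x (show s < m n by omega) j (Finset.mem_range.mp hj).le)]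
    rw [Finset.sum_add_distrib, Finset.sum_const, Finset.card_range, nsmul_eq_mul,
      ← Finset.mul_sum (Finset.range (M m n))]
    ring

lemma mulK' (m : ℕ → ℕ) (N : ℕ) (hN : 0 < N) (x : G m) :
    (N : ℂ) * K m N x = ∑ k ∈ Finset.range N, D m k x := by
  rw [K, mul_inv_cancel_left₀ (Nat.cast_ne_zero.mpr hN.ne')]

end Vilenkin

theorem statement5 (m : ℕ → ℕ) (hm : ∀ k, 2 ≤ m k) (n s : ℕ)
    (hs1 : 1 ≤ s) (hs2 : s ≤ m n - 1) (x : G m) :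
    ((s * M m n : ℕ) : ℂ) * K m (s * M m n) x =
      (∑ l ∈ Finset.range s, ∑ i ∈ Finset.range l, rad m n x ^ i) * (M m n : ℂ) * D m (M m n) x
      + (∑ l ∈ Finset.range s, rad m n x ^ l) * (M m n : ℂ) * K m (M m n) x := by
  have hM := M_pos' m hm n
  rw [mulK' m _ (Nat.mul_pos hs1 hM), sumD' m hm n x s (by omega), mul_assoc (∑ l ∈ Finset.range s, rad m n x ^ l),
    mulK' m _ hM]
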